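/- For any four partitions α₁, α₂, β₁, β₂, one has (α₁ ⊔ β₁) + (α₂ ⊔ β₂) ≥ (α₁ + α₂) ⊔ (β₁ + β₂) in the dominance order (both sides are partitions of |α₁| + |α₂| + |β₁| + |β₂|). -/

import Mathlib

/-- A partition: a finite multiset of positive integers. -/
def IsPartition (p : Multiset ℕ) : Prop := ∀ x ∈ p, 0 < x

/-- The parts of `p` in weakly decreasing order. -/
def descList (p : Multiset ℕ) : List ℕ := (p.sort (· ≤ ·)).reverse

/-- The sum of the `j` largest parts of `p` (padding with trailing zeros). -/
def topSum (p : Multiset ℕ) (j : ℕ) : ℕ := ((descList p).take j).sum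

/-- Dominance order: `DomLE α β` means `α ≤ β`, i.e. each partial sum of the
largest parts of `α` is at most the corresponding partial sum for `β`. -/
def DomLE (α β : Multiset ℕ) : Prop := ∀ j : ℕ, topSum α j ≤ topSum β j

/-- Transpose of a partition: the `j`-th part is the number of parts `≥ j`. -/
def transposeP (p : Multiset ℕ) : Multiset ℕ :=
  ((Multiset.range p.sum).map fun j => (p.filter fun x => j + 1 ≤ x).card).filter
    fun c => c ≠ 0

/-- The weakly decreasing list of parts padded with zeros to length `n`. -/
def padDesc (p : Multiset ℕ) (n : ℕ) : List ℕ :=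
  descList p ++ List.replicate (n - Multiset.card p) 0

/-- The sum of two partitions: add the parts pointwise after sorting in
weakly decreasing order and padding with trailing zeros. -/
def sumParts (p q : Multiset ℕ) : Multiset ℕ :=
  (↑(List.zipWith (· + ·)
      (padDesc p (max (Multiset.card p) (Multiset.card q)))
      (padDesc q (max (Multiset.card p) (Multiset.card q)))) : Multiset ℕ).filter
    fun x => x ≠ 0

/-- The string `[a] = (a, a-2, a-4, …, 2 or 1)`, empty for `a = 0`. -/
def strP (a : ℕ) : Multiset ℕ := (Multiset.range ((a + 1) / 2)).map fun k => a - 2 * k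

/-- The partition `(a, a-1, …, 2, 1)`. -/
def downP (a : ℕ) : Multiset ℕ := (Multiset.range a).map fun k => a - k

/-- The partition `(2a-1, 2a-3, …, 3, 1)`. -/
def oddsDown (a : ℕ) : Multiset ℕ := (Multiset.range a).map fun k => 2 * (a - k) - 1

/-- The partition `(2a, 2a-2, …, 4, 2)`. -/
def evensDown (a : ℕ) : Multiset ℕ := (Multiset.range a).map fun k => 2 * (a - k)

/-- `p⁻`: decrease the smallest part of `p` by 1 (deleting it if it was 1). -/
def pMinus (p : Multiset ℕ) : Multiset ℕ :=
  match p.sort (· ≤ ·) with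
  | [] => 0
  | a :: rest => (↑rest : Multiset ℕ) + (if a ≤ 1 then 0 else {a - 1})

/-- A partition is symplectic if every odd part occurs with even multiplicity. -/
def IsSymplectic (p : Multiset ℕ) : Prop := ∀ x : ℕ, Odd x → Even (p.count x)

/-- A partition is orthogonal if every even part occurs with even multiplicity. -/
def IsOrthogonal (p : Multiset ℕ) : Prop := ∀ x : ℕ, Even x → Even (p.count x)

/-- `IsCCollapse p q`: `q` is the C-collapse `p_C` of `p`, i.e. the unique maximal
symplectic partition of the same total that is `≤ p` in the dominance order. -/
def IsCCollapse (p q : Multiset ℕ) : Prop :=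
  IsPartition q ∧ IsSymplectic q ∧ q.sum = p.sum ∧ DomLE q p ∧
    ∀ r : Multiset ℕ, IsPartition r → IsSymplectic r → r.sum = p.sum → DomLE r p → DomLE r q

theorem coe_descList (p : Multiset ℕ) : (↑(descList p) : Multiset ℕ) = p := by
  simp [descList]

theorem pairwise_descList (p : Multiset ℕ) : (descList p).Pairwise (· ≥ ·) := by
  rw [descList, List.pairwise_reverse]
  exact p.pairwise_sort (· ≤ ·)

theorem descList_coe {l : List ℕ} (hl : l.Pairwise (· ≥ ·)) :
    descList (↑l : Multiset ℕ) = l :=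
  (Multiset.coe_eq_coe.mp (coe_descList _)).eq_of_pairwise
    (fun _ _ _ _ h₁ h₂ => le_antisymm h₂ h₁) (pairwise_descList _) hl

theorem sum_take_succ_le {a : ℕ} {l : List ℕ} (h : ∀ x ∈ l, x ≤ a) (j : ℕ) :
    (l.take (j + 1)).sum ≤ a + (l.take j).sum := by
  rw [List.take_add_one, List.sum_append, add_comm]
  gcongr
  cases hj : l[j]? with
  | none => simp
  | some x => simpa using h x (List.mem_of_getElem? hj)

theorem List.Sublist.sum_le_sum_take {l' l : List ℕ} (h : l'.Sublist l)
    (hl : l.Pairwise (· ≥ ·)) {j : ℕ} (hj : l'.length ≤ j) :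
    l'.sum ≤ (l.take j).sum := by
  induction h generalizing j with
  | slnil => simp
  | @cons l₁ l₂ a h ih =>
    rw [List.pairwise_cons] at hl
    cases j with
    | zero => simp [List.length_eq_zero_iff.mp (Nat.le_zero.mp hj)]
    | succ j =>
      simpa using (ih hl.2 hj).trans (sum_take_succ_le hl.1 j)
  | @cons_cons l₁ l₂ a h ih =>
    rw [List.pairwise_cons] at hl
    cases j with
    | zero => simp at hj
    | succ j => simpa using ih hl.2 (by simpa using hj)

/-- Any `j` or fewer parts of `p` have sum at most that of the `j` largest parts. -/
theorem sum_le_topSum {s p : Multiset ℕ} (h : s ≤ p) {j : ℕ} (hj : s.card ≤ j) :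
    s.sum ≤ topSum p j := by
  have hsub : s.toList.Subperm (descList p) := by
    rw [← Multiset.coe_le, Multiset.coe_toList, coe_descList]
    exact h
  obtain ⟨l, hperm, hl⟩ := hsub
  rw [← Multiset.sum_toList, ← hperm.sum_eq]
  exact hl.sum_le_sum_take (pairwise_descList p) (by simpa [hperm.length_eq] using hj)

theorem exists_le_sum_eq_topSum (p : Multiset ℕ) (j : ℕ) :
    ∃ s ≤ p, s.card ≤ j ∧ s.sum = topSum p j := by
  refine ⟨↑((descList p).take j), ?_, by simp, by simp [topSum]⟩
  conv_rhs => rw [← coe_descList p]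
  exact Multiset.coe_le.mpr (List.take_sublist _ _).subperm

theorem topSum_mono (p : Multiset ℕ) : Monotone (topSum p) := by
  intro i j hij
  obtain ⟨s, hs, hc, h⟩ := exists_le_sum_eq_topSum p i
  exact h ▸ sum_le_topSum hs (hc.trans hij)

theorem topSum_add_topSum_le (p q : Multiset ℕ) (i j : ℕ) :
    topSum p i + topSum q j ≤ topSum (p + q) (i + j) := by
  obtain ⟨s, hs, hsc, h⟩ := exists_le_sum_eq_topSum p i
  obtain ⟨t, ht, htc, h'⟩ := exists_le_sum_eq_topSum q j
  rw [← h, ← h', ← Multiset.sum_add]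
  exact sum_le_topSum (add_le_add hs ht) (by simpa using add_le_add hsc htc)

theorem exists_topSum_add_le (p q : Multiset ℕ) (j : ℕ) :
    ∃ k l, k + l ≤ j ∧ topSum (p + q) j ≤ topSum p k + topSum q l := by
  obtain ⟨s, hs, hc, h⟩ := exists_le_sum_eq_topSum (p + q) j
  have hsp : s - p ≤ q := tsub_le_iff_left.mpr hs
  have hs' : s ∩ p + (s - p) = s := by rw [add_comm]; exact Multiset.sub_add_inter s p
  refine ⟨(s ∩ p).card, (s - p).card, by rwa [← Multiset.card_add, hs'], ?_⟩
  rw [← h, ← hs', Multiset.sum_add, hs']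
  exact add_le_add (sum_le_topSum Multiset.inter_le_right le_rfl) (sum_le_topSum hsp le_rfl)

theorem Multiset.sum_filter_ne_zero (s : Multiset ℕ) : (s.filter (· ≠ 0)).sum = s.sum := by
  induction s using Multiset.induction_on with
  | empty => simp
  | cons a s ih => by_cases h : a = 0 <;> simp_all

theorem topSum_filter_ne_zero (p : Multiset ℕ) (j : ℕ) :
    topSum (p.filter (· ≠ 0)) j = topSum p j := by
  apply le_antisymm
  · obtain ⟨s, hs, hc, h⟩ := exists_le_sum_eq_topSum (p.filter (· ≠ 0)) j
    exact h ▸ sum_le_topSum (hs.trans (Multiset.filter_le _ _)) hc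
  · obtain ⟨s, hs, hc, h⟩ := exists_le_sum_eq_topSum p j
    rw [← h, ← Multiset.sum_filter_ne_zero]
    exact sum_le_topSum (Multiset.filter_le_filter _ hs)
      ((Multiset.card_le_card (Multiset.filter_le _ _)).trans hc)

theorem List.Pairwise.zipWith_add {l m : List ℕ} (hl : l.Pairwise (· ≥ ·))
    (hm : m.Pairwise (· ≥ ·)) : (List.zipWith (· + ·) l m).Pairwise (· ≥ ·) := by
  rw [List.pairwise_iff_getElem] at *
  intro i j hi hj hij
  simp only [List.length_zipWith, lt_min_iff] at hi hj
  simpa using add_le_add (hl i j hi.1 hj.1 hij) (hm i j hi.2 hj.2 hij)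

theorem sum_zipWith_add {l m : List ℕ} (h : l.length = m.length) :
    (List.zipWith (· + ·) l m).sum = l.sum + m.sum := by
  induction l generalizing m with
  | nil => simp_all [eq_comm]
  | cons a l ih =>
    cases m with
    | nil => simp at h
    | cons b m =>
      have := ih (m := m) (by simpa using h)
      simp only [List.zipWith_cons_cons, List.sum_cons, this]
      ring

theorem length_padDesc (p : Multiset ℕ) {n : ℕ} (h : p.card ≤ n) : (padDesc p n).length = n := by
  simp [padDesc, descList, h]

theorem pairwise_padDesc (p : Multiset ℕ) (n : ℕ) : (padDesc p n).Pairwise (· ≥ ·) := by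
  rw [padDesc, List.pairwise_append]
  refine ⟨pairwise_descList p, by simp [List.pairwise_replicate], ?_⟩
  intro a _ b hb
  simp [List.eq_of_mem_replicate hb]

theorem sum_take_padDesc (p : Multiset ℕ) (n j : ℕ) : ((padDesc p n).take j).sum = topSum p j := by
  simp [padDesc, topSum, List.take_append]

theorem topSum_sumParts (p q : Multiset ℕ) (j : ℕ) :
    topSum (sumParts p q) j = topSum p j + topSum q j := by
  rw [sumParts, topSum_filter_ne_zero, topSum,
    descList_coe ((pairwise_padDesc p _).zipWith_add (pairwise_padDesc q _)), List.take_zipWith,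
    sum_zipWith_add, sum_take_padDesc, sum_take_padDesc]
  rw [List.length_take, List.length_take, length_padDesc p (le_max_left _ _),
    length_padDesc q (le_max_right _ _)]

/-- for any four partitions,
`(α₁ ⊔ β₁) + (α₂ ⊔ β₂) ≥ (α₁ + α₂) ⊔ (β₁ + β₂)` in the dominance order. -/
theorem sumParts_concat_four (α₁ α₂ β₁ β₂ : Multiset ℕ)
    (hα₁ : IsPartition α₁) (hα₂ : IsPartition α₂)
    (hβ₁ : IsPartition β₁) (hβ₂ : IsPartition β₂) :
    DomLE (sumParts α₁ α₂ + sumParts β₁ β₂) (sumParts (α₁ + β₁) (α₂ + β₂)) := by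
  intro j
  obtain ⟨k, l, hkl, h⟩ := exists_topSum_add_le (sumParts α₁ α₂) (sumParts β₁ β₂) j
  refine (h.trans ?_).trans (topSum_mono _ hkl)
  simp only [topSum_sumParts]
  have h₁ := topSum_add_topSum_le α₁ β₁ k l
  have h₂ := topSum_add_topSum_le α₂ β₂ k l
  lia
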